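/- Finiteness theorem: for an ideal I ⊆ K[x_1,…,x_n] over a field K with algebraic closure K̄, the following are equivalent: (a) the set of common zeros V(I) ⊆ K̄^n of I is finite; (b) the quotient K[x_1,…,x_n]/I is a finite-dimensional K-vector space; (c) for every i ∈ {1,…,n}, I ∩ K[x_i] ≠ {0}. -/

import Mathlib

open MvPolynomial

/-- **Finiteness theorem.** For an ideal `I ⊆ K[x_1,…,x_n]` over a field
`K` with algebraic closure `L`, the following are equivalent: (a) the zero set
`V(I) ⊆ L^n` is finite; (b) `K[x_1,…,x_n]/I` is a finite-dimensional `K`-vector space;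
(c) for every `i`, `I ∩ K[x_i] ≠ {0}`. -/
theorem finiteness_theorem_tfae
    {n : ℕ} {K L : Type*} [Field K] [Field L] [Algebra K L] [IsAlgClosure K L]
    (I : Ideal (MvPolynomial (Fin n) K)) :
    List.TFAE [
      {a : Fin n → L | ∀ f ∈ I, MvPolynomial.aeval a f = 0}.Finite,
      FiniteDimensional K (MvPolynomial (Fin n) K ⧸ I),
      ∀ i : Fin n, ∃ p : Polynomial K, p ≠ 0 ∧
        Polynomial.aeval (MvPolynomial.X i : MvPolynomial (Fin n) K) p ∈ I ] := by
  have hL : IsAlgClosed L := IsAlgClosure.isAlgClosed K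
  have hA : Algebra.IsAlgebraic K L := IsAlgClosure.isAlgebraic
  tfae_have 1 → 3 := by
    intro hfin i
    set q : Polynomial K := ∏ a ∈ hfin.toFinset, minpoly K (a i) with hq
    have hq0 : q ≠ 0 := Finset.prod_ne_zero_iff.2 fun a _ =>
      minpoly.ne_zero (Algebra.IsIntegral.isIntegral (a i))
    have hmem : Polynomial.aeval (X i : MvPolynomial (Fin n) K) q ∈
        vanishingIdeal K (zeroLocus L I) := by
      intro a ha
      rw [← Polynomial.aeval_algHom_apply, aeval_X, hq, map_prod]
      exact Finset.prod_eq_zero (hfin.mem_toFinset.2 ha) (minpoly.aeval K (a i))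
    rw [vanishingIdeal_zeroLocus_eq_radical] at hmem
    obtain ⟨k, hk⟩ := hmem
    exact ⟨q ^ k, pow_ne_zero k hq0, by rwa [map_pow]⟩
  tfae_have 3 → 2 := by
    intro h
    have hint : Algebra.IsIntegral K (MvPolynomial (Fin n) K ⧸ I) := by
      refine ⟨fun x => ?_⟩
      obtain ⟨f, rfl⟩ := Ideal.Quotient.mkₐ_surjective K I x
      induction f using MvPolynomial.induction_on with
      | C a => exact isIntegral_algebraMap (R := K) (x := a)
      | add f g hf hg => rw [map_add]; exact hf.add hg
      | mul_X f i hf =>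
        rw [map_mul]
        refine hf.mul (IsAlgebraic.isIntegral ?_)
        obtain ⟨p, hp0, hp⟩ := h i
        refine ⟨p, hp0, ?_⟩
        rw [Polynomial.aeval_algHom_apply]
        exact Ideal.Quotient.eq_zero_iff_mem.2 hp
    exact Algebra.IsIntegral.finite
  tfae_have 2 → 3 := by
    intro h i
    obtain ⟨p, hp0, hp⟩ := Algebra.IsAlgebraic.isAlgebraic (R := K)
      (Ideal.Quotient.mkₐ K I (X i))
    rw [Polynomial.aeval_algHom_apply] at hp
    exact ⟨p, hp0, Ideal.Quotient.eq_zero_iff_mem.1 hp⟩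
  tfae_have 3 → 1 := by
    intro h
    choose p hp0 hp using h
    refine (Set.Finite.pi' fun i => (p i).rootSet_finite L).subset fun a ha i => ?_
    have := ha _ (hp i)
    rw [← Polynomial.aeval_algHom_apply, aeval_X] at this
    exact Polynomial.mem_rootSet.2 ⟨hp0 i, this⟩
  tfae_finish
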